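/- Let π be a finite Borel measure on 𝒫, let f_n, f: 𝒫 → [0,∞) be measurable with each f_n essentially bounded (with respect to π) and ‖f_n − f‖_∞ → 0 as n → ∞, where ‖·‖_∞ denotes the π-essential supremum, and assume ‖f‖_∞ > 0; let (m_n) be an increasing sequence of positive reals with m_n → ∞ and assume 0 < ∫_𝒫 f_n^{m_n} dπ < ∞ for every n, so that μ_n(E) := (∫_E f_n^{m_n} dπ)/(∫_𝒫 f_n^{m_n} dπ) defines probability measures on 𝒫. Let 𝒮 be the (closed) support of π, 𝒮* := {q ∈ 𝒮 : f(q) = ‖f‖_∞} and 𝒮*_δ := {q ∈ 𝒮 : f(q) > ‖f‖_∞ − δ}. Then: (i) for every δ > 0, μ_n(𝒮*_δ) → 1 as n → ∞; (ii) if μ is a Borel probability measure on 𝒫 with μ(⋂_{δ>0} closure(𝒮*_δ) \ 𝒮*) = 0 (for instance if f is upper semicontinuous) and μ_n converges weakly to μ, then μ(𝒮*) = 1. -/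

import Mathlib

open MeasureTheory Filter Topology

/-- The space of probability measures on a Polish space is hereditarily Lindelof. -/
theorem aux_lindelof {X : Type*} [MeasurableSpace X] [TopologicalSpace X] [PolishSpace X]
    [BorelSpace X] : HereditarilyLindelofSpace (ProbabilityMeasure X) := by
  let V : Finset (TopologicalSpace.countableBasis X) → Set X := fun T => ⋃ t ∈ T, (t : Set X)
  let W : Finset (TopologicalSpace.countableBasis X) × ℚ → Set (ProbabilityMeasure X) :=
    fun p => {Q | (p.2 : ℝ) < (Q (V p.1) : ℝ)}
  have hcount : (Set.range W).Countable := by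
    have : Countable (TopologicalSpace.countableBasis X) :=
      (TopologicalSpace.countable_countableBasis X).to_subtype
    exact Set.countable_range W
  have ht2 : @SecondCountableTopology _ (TopologicalSpace.generateFrom (Set.range W)) :=
    @SecondCountableTopology.mk _ (TopologicalSpace.generateFrom (Set.range W)) ⟨Set.range W, hcount, rfl⟩
  have hcont : @Continuous _ _ (TopologicalSpace.generateFrom (Set.range W)) _ (id : ProbabilityMeasure X → ProbabilityMeasure X) := by
    refine (@continuous_iff_continuousAt _ _ (TopologicalSpace.generateFrom (Set.range W)) _ _).2 fun P => ?_
    have hcg : (@nhds _ (TopologicalSpace.generateFrom (Set.range W)) P).IsCountablyGenerated :=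
      @FirstCountableTopology.nhds_generated_countable _ (TopologicalSpace.generateFrom (Set.range W))
        (@TopologicalSpace.SecondCountableTopology.to_firstCountableTopology _ (TopologicalSpace.generateFrom (Set.range W)) ht2) P
    refine tendsto_of_forall_isOpen_le_liminf' (L := @nhds _ (TopologicalSpace.generateFrom (Set.range W)) P) (μs := id) ?_
    intro G hG
    refine le_of_forall_lt fun c hc => ?_
    have hcT : c ≠ ⊤ := ne_top_of_lt hc
    lift c to NNReal using hcT
    rw [← ProbabilityMeasure.ennreal_coeFn_eq_coeFn_toMeasure, ENNReal.coe_lt_coe] at hc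
    obtain ⟨c', hc1, hc2⟩ := exists_between hc
    obtain ⟨T, hT1, hT2, hT3⟩ :=
      ProbabilityMeasure.exists_lt_measure_biUnion_of_isOpen
        (S := TopologicalSpace.countableBasis X) P (by
          intro u hu x hx
          obtain ⟨s, hs, hxs, hsu⟩ :=
            (TopologicalSpace.isBasis_countableBasis X).exists_subset_of_mem_open hx hu
          exact ⟨s, hs, ((TopologicalSpace.isBasis_countableBasis X).isOpen hs).mem_nhds hxs, hsu⟩)
        hG hc2
    obtain ⟨T', hT'⟩ : ∃ T' : Finset (TopologicalSpace.countableBasis X),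
        V T' = ⋃ t ∈ T, t := by
      classical
      refine ⟨T.subtype (· ∈ TopologicalSpace.countableBasis X), ?_⟩
      ext x
      simp only [V, Set.mem_iUnion, Finset.mem_subtype, exists_prop, Subtype.exists]
      constructor
      · rintro ⟨a, _, h1, h2⟩
        exact ⟨a, h1, h2⟩
      · rintro ⟨a, h1, h2⟩
        exact ⟨a, hT1 a h1, h1, h2⟩
    rw [← hT'] at hT2 hT3
    obtain ⟨q, hq1, hq2⟩ := exists_rat_btwn (NNReal.coe_lt_coe.2 hT2)
    have hopen : IsOpen[TopologicalSpace.generateFrom (Set.range W)] (W (T', q)) := TopologicalSpace.isOpen_generateFrom_of_mem ⟨_, rfl⟩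
    have hmem : W (T', q) ∈ @nhds _ (TopologicalSpace.generateFrom (Set.range W)) P := 
      @IsOpen.mem_nhds _ (TopologicalSpace.generateFrom (Set.range W)) _ _ hopen hq2
    refine lt_of_lt_of_le (ENNReal.coe_lt_coe.2 hc1) ?_
    refine le_liminf_of_le (by isBoundedDefault) ?_
    filter_upwards [hmem] with Q hQ
    have h1 : (c' : ℝ) < Q (V T') := hq1.trans hQ
    have h2 : c' < Q (V T') := by exact_mod_cast h1
    have h3 : Q (V T') ≤ Q G := ProbabilityMeasure.apply_mono Q hT3
    have h4 := h2.le.trans h3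
    simp only [id]
    rw [← ProbabilityMeasure.ennreal_coeFn_eq_coeFn_toMeasure]
    exact ENNReal.coe_le_coe.2 h4
  refine HereditarilyLindelofSpace.of_forall_isOpen fun s _ => ?_
  have hL : @IsLindelof _ (TopologicalSpace.generateFrom (Set.range W)) s :=
    @HereditarilyLindelofSpace.isLindelof _ (TopologicalSpace.generateFrom (Set.range W))
      (@SecondCountableTopology.toHereditarilyLindelof _ (TopologicalSpace.generateFrom (Set.range W)) ht2) s
  have := @IsLindelof.image _ _ (TopologicalSpace.generateFrom (Set.range W)) _ _ _ hL hcont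
  simpa using this

theorem aux_ratio {Ω : Type*} [MeasurableSpace Ω] (π : Measure Ω) [IsFiniteMeasure π]
    (fn : ℕ → Ω → ℝ) (f : Ω → ℝ)
    (hfmeas : Measurable f)
    (hfn0 : ∀ n q, 0 ≤ fn n q) (hf0 : ∀ q, 0 ≤ f q)
    (hfnbdd : ∀ n, ∃ C : ℝ, ∀ᵐ q ∂π, fn n q ≤ C)
    (hunif : Tendsto (fun n => essSup (fun q => |fn n q - f q|) π) atTop (𝓝 0))
    (hfsup_pos : 0 < essSup f π)
    (m : ℕ → ℝ) (hmpos : ∀ n, 0 < m n)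
    (hmtop : Tendsto m atTop atTop)
    (hIntpos : ∀ n, 0 < ∫ q, fn n q ^ m n ∂π)
    (hInt : ∀ n, Integrable (fun q => fn n q ^ m n) π) (δ : ℝ) (hδ : 0 < δ) :
    Tendsto (fun n => (∫ q in {q | f q ≤ essSup f π - δ}, fn n q ^ m n ∂π)
      / ∫ q, fn n q ^ m n ∂π) atTop (𝓝 0) := by
  set M := essSup f π with hM
  have hne : {a : ℝ | π {x | a < f x} = 0}.Nonempty := by
    by_contra h
    rw [Set.not_nonempty_iff_eq_empty] at h
    rw [essSup_eq_sInf, h, Real.sInf_empty] at hM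
    linarith
  obtain ⟨C, hC⟩ := hne
  have hfC : ∀ᵐ q ∂π, f q ≤ C := by
    rw [ae_iff]; simpa using hC
  obtain ⟨ε, hε, hεM, hεδ⟩ : ∃ ε : ℝ, 0 < ε ∧ 4 * ε ≤ M ∧ 4 * ε ≤ δ :=
    ⟨min M δ / 4, by have := lt_min hfsup_pos hδ; linarith,
      by have := min_le_left M δ; linarith, by have := min_le_right M δ; linarith⟩
  -- the set where `f` is almost maximal has positive measure
  have hApos : 0 < π.real {q | M - ε < f q} := by
    rw [Measure.real, ENNReal.toReal_pos_iff]
    refine ⟨pos_iff_ne_zero.2 fun h0 => ?_, measure_lt_top _ _⟩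
    have : M ≤ M - ε := by
      rw [hM, essSup_eq_sInf, ← essSup_eq_sInf, ← hM]
      conv_lhs => rw [hM, essSup_eq_sInf]
      refine csInf_le ⟨0, ?_⟩ h0
      intro a ha
      by_contra hneg
      push Not at hneg
      have : {x | a < f x} = Set.univ := Set.eq_univ_of_forall fun x => hneg.trans_le (hf0 x)
      have hz : π = 0 := by
        rw [← Measure.measure_univ_eq_zero, ← this]; exact ha
      have := hIntpos 0
      rw [hz] at this
      simp at this
    linarith
  have hAm : MeasurableSet {q | M - ε < f q} := measurableSet_lt measurable_const hfmeas
  set A := {q | M - ε < f q} with hA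
  set B := {q | f q ≤ M - δ} with hB
  have hBm : MeasurableSet B := measurableSet_le hfmeas measurable_const
  have hae : ∀ᶠ n in atTop, ∀ᵐ q ∂π, |fn n q - f q| < ε := by
    filter_upwards [hunif.eventually (gt_mem_nhds hε)] with n hn
    refine ae_lt_of_essSup_lt hn ?_
    obtain ⟨D, hD⟩ := hfnbdd n
    refine ⟨D + C, ?_⟩
    rw [eventually_map]
    filter_upwards [hD, hfC] with q h1 h2
    have h3 := hfn0 n q
    have h4 := hf0 q
    exact abs_le.2 ⟨by linarith, by linarith⟩
  have hb0 : 0 ≤ M - 3 * ε := by linarith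
  have hd0 : 0 < M - 2 * ε := by linarith
  have hlim : Tendsto (fun n => ((M - 3 * ε) / (M - 2 * ε)) ^ m n * (π.real Set.univ / π.real A))
      atTop (𝓝 0) := by
    have h := (tendsto_rpow_atTop_of_base_lt_one ((M - 3 * ε) / (M - 2 * ε))
      (by have := div_nonneg hb0 hd0.le; linarith)
      (by rw [div_lt_one hd0]; linarith)).comp hmtop
    simpa using h.mul_const (π.real Set.univ / π.real A)
  refine squeeze_zero' (Eventually.of_forall fun n => ?_) ?_ hlim
  · exact div_nonneg (integral_nonneg fun q => Real.rpow_nonneg (hfn0 n q) _) (hIntpos n).le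
  filter_upwards [hae] with n hn
  have hnum : ∫ q in B, fn n q ^ m n ∂π ≤ (M - 3 * ε) ^ m n * π.real Set.univ := by
    calc ∫ q in B, fn n q ^ m n ∂π ≤ ∫ q in B, (M - 3 * ε) ^ m n ∂π := by
          refine setIntegral_mono_on_ae (hInt n).integrableOn (integrable_const _) hBm ?_
          filter_upwards [hn] with q hq hqB
          have h1 : f q ≤ M - δ := hqB
          have h2 := (abs_lt.1 hq).2
          exact Real.rpow_le_rpow (hfn0 n q) (by linarith) (hmpos n).le
      _ = π.real B * (M - 3 * ε) ^ m n := by simp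
      _ ≤ (M - 3 * ε) ^ m n * π.real Set.univ := by
          rw [mul_comm]
          exact mul_le_mul_of_nonneg_left (measureReal_mono (Set.subset_univ _))
            (Real.rpow_nonneg hb0 _)
  have hden : (M - 2 * ε) ^ m n * π.real A ≤ ∫ q, fn n q ^ m n ∂π := by
    calc (M - 2 * ε) ^ m n * π.real A = ∫ q in A, (M - 2 * ε) ^ m n ∂π := by
          simp [mul_comm]
      _ ≤ ∫ q in A, fn n q ^ m n ∂π := by
          refine setIntegral_mono_on_ae (integrable_const _) (hInt n).integrableOn hAm ?_
          filter_upwards [hn] with q hq hqA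
          have h1 : M - ε < f q := hqA
          have h2 := (abs_lt.1 hq).1
          exact Real.rpow_le_rpow hd0.le (by linarith) (hmpos n).le
      _ ≤ ∫ q, fn n q ^ m n ∂π :=
          setIntegral_le_integral (hInt n)
            (Eventually.of_forall fun q => Real.rpow_nonneg (hfn0 n q) _)
  calc _ ≤ ((M - 3 * ε) ^ m n * π.real Set.univ) / ((M - 2 * ε) ^ m n * π.real A) :=
        div_le_div₀ (mul_nonneg (Real.rpow_nonneg hb0 _) measureReal_nonneg) hnum
          (mul_pos (Real.rpow_pos_of_pos hd0 _) hApos) hden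
    _ = _ := by rw [Real.div_rpow hb0 hd0.le, mul_div_mul_comm]

/-- **Proposition `point2`.**
`π` is a finite measure on `𝒫 = 𝒫(X)`, `fₙ, f : 𝒫 → [0,∞)` measurable, the `fₙ`
essentially bounded with `‖fₙ − f‖_∞ → 0`, `mₙ ↑ ∞`, and
`μₙ(E) = (∫_E fₙ^{mₙ} dπ)/(∫ fₙ^{mₙ} dπ)`.  With `𝒮` the support of `π`,
`𝒮* = {q ∈ 𝒮 : f(q) = ‖f‖_∞}` and `𝒮*_δ = {q ∈ 𝒮 : f(q) > ‖f‖_∞ − δ}`: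
(i) `μₙ(𝒮*_δ) → 1` for every `δ > 0`;
(ii) if `μ(⋂_{δ>0} closure(𝒮*_δ) \ 𝒮*) = 0` and `μₙ ⇒ μ`, then `μ(𝒮*) = 1`. -/
theorem stmt_8
    {X : Type*} [MeasurableSpace X] [TopologicalSpace X] [PolishSpace X] [BorelSpace X]
    [MeasurableSpace (ProbabilityMeasure X)] [BorelSpace (ProbabilityMeasure X)]
    (π : Measure (ProbabilityMeasure X)) [IsFiniteMeasure π]
    (fn : ℕ → ProbabilityMeasure X → ℝ) (f : ProbabilityMeasure X → ℝ)
    (hfnmeas : ∀ n, Measurable (fn n)) (hfmeas : Measurable f)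
    (hfn0 : ∀ n q, 0 ≤ fn n q) (hf0 : ∀ q, 0 ≤ f q)
    (hfnbdd : ∀ n, ∃ C : ℝ, ∀ᵐ q ∂π, fn n q ≤ C)
    (hunif : Tendsto (fun n => essSup (fun q => |fn n q - f q|) π) atTop (𝓝 0))
    (hfsup_pos : 0 < essSup f π)
    (m : ℕ → ℝ) (hmpos : ∀ n, 0 < m n) (hmmono : StrictMono m)
    (hmtop : Tendsto m atTop atTop)
    (hIntpos : ∀ n, 0 < ∫ q, fn n q ^ m n ∂π)
    (hInt : ∀ n, Integrable (fun q => fn n q ^ m n) π)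
    (S : Set (ProbabilityMeasure X))
    (hS : S = {p : ProbabilityMeasure X | ∀ U : Set (ProbabilityMeasure X),
      IsOpen U → p ∈ U → 0 < π U})
    (Sstar : Set (ProbabilityMeasure X))
    (hSstar : Sstar = {q ∈ S | f q = essSup f π})
    (Sdelta : ℝ → Set (ProbabilityMeasure X))
    (hSdelta : ∀ δ : ℝ, Sdelta δ = {q ∈ S | essSup f π - δ < f q})
    (μn : ℕ → ProbabilityMeasure (ProbabilityMeasure X))
    (hμn : ∀ (n : ℕ) (E : Set (ProbabilityMeasure X)), MeasurableSet E →
      ((μn n : Measure (ProbabilityMeasure X)) E).toReal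
        = (∫ q in E, fn n q ^ m n ∂π) / ∫ q, fn n q ^ m n ∂π) :
    (∀ δ : ℝ, 0 < δ →
      Tendsto (fun n => ((μn n : Measure (ProbabilityMeasure X)) (Sdelta δ)).toReal)
        atTop (𝓝 1))
    ∧ (∀ μ : ProbabilityMeasure (ProbabilityMeasure X),
        (μ : Measure (ProbabilityMeasure X))
            ((⋂ δ ∈ Set.Ioi (0 : ℝ), closure (Sdelta δ)) \ Sstar) = 0 →
        Tendsto μn atTop (𝓝 μ) →
        (μ : Measure (ProbabilityMeasure X)) Sstar = 1) := by
  have hLind := aux_lindelof (X := X)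
  have hSsup : S = π.support := by
    rw [hS, Measure.support_eq_forall_isOpen]
    ext p
    exact ⟨fun h u a b => h u b a, fun h u a b => h u b a⟩
  have hSclosed : IsClosed S := by rw [hSsup]; exact Measure.isClosed_support
  have hSnull : π Sᶜ = 0 := by rw [hSsup]; exact Measure.measure_compl_support
  have hSdm : ∀ δ, MeasurableSet (Sdelta δ) := fun δ => by
    rw [hSdelta]
    exact hSclosed.measurableSet.inter (measurableSet_lt measurable_const hfmeas)
  have h1 : ∀ δ : ℝ, 0 < δ →
      Tendsto (fun n => ((μn n : Measure (ProbabilityMeasure X)) (Sdelta δ)).toReal)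
        atTop (𝓝 1) := by
    intro δ hδ
    have key := aux_ratio π fn f hfmeas hfn0 hf0 hfnbdd hunif hfsup_pos m hmpos hmtop
      hIntpos hInt δ hδ
    have key2 := key.const_sub 1
    rw [sub_zero] at key2
    refine key2.congr fun n => ?_
    rw [hμn n _ (hSdm δ)]
    have hBm : MeasurableSet {q | f q ≤ essSup f π - δ} := measurableSet_le hfmeas measurable_const
    have hcongr : ∫ q in Sdelta δ, fn n q ^ m n ∂π
        = ∫ q in {q | f q ≤ essSup f π - δ}ᶜ, fn n q ^ m n ∂π := by
      refine setIntegral_congr_set ?_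
      have hSae : ∀ᵐ q ∂π, q ∈ S := hSnull
      filter_upwards [hSae] with q hq
      rw [hSdelta]
      apply propext
      change (q ∈ S ∧ essSup f π - δ < f q) ↔ ¬ (f q ≤ essSup f π - δ)
      rw [not_le]
      exact ⟨fun h => h.2, fun h => ⟨hq, h⟩⟩
    rw [hcongr, eq_div_iff (hIntpos n).ne', sub_mul, div_mul_cancel₀ _ (hIntpos n).ne',
      ← integral_add_compl hBm (hInt n)]
    ring
  refine ⟨h1, fun μ hμ hlim => ?_⟩
  have hcl : ∀ δ : ℝ, 0 < δ → (μ : Measure (ProbabilityMeasure X)) (closure (Sdelta δ)) = 1 := by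
    intro δ hδ
    refine le_antisymm prob_le_one ?_
    refine le_trans ?_ (ProbabilityMeasure.limsup_measure_closed_le_of_tendsto hlim
      (isClosed_closure (s := Sdelta δ)))
    have ht : Tendsto (fun n => (μn n : Measure (ProbabilityMeasure X)) (Sdelta δ)) atTop (𝓝 1) := by
      rw [← ENNReal.tendsto_toReal_iff (fun n => measure_ne_top _ _) ENNReal.one_ne_top]
      simpa using h1 δ hδ
    rw [← ht.limsup_eq]
    exact limsup_le_limsup (Eventually.of_forall fun n => measure_mono subset_closure)
  have hmono : ∀ a b : ℝ, a ≤ b → Sdelta a ⊆ Sdelta b := by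
    intro a b hab q hq
    rw [hSdelta] at hq ⊢
    exact ⟨hq.1, by have := hq.2; linarith⟩
  have hInter : (μ : Measure (ProbabilityMeasure X))
      (⋂ δ ∈ Set.Ioi (0 : ℝ), closure (Sdelta δ))ᶜ = 0 := by
    have hsub : (⋂ δ ∈ Set.Ioi (0 : ℝ), closure (Sdelta δ))ᶜ
        ⊆ ⋃ k : ℕ, (closure (Sdelta (1 / ((k : ℝ) + 1))))ᶜ := by
      rw [← Set.compl_iInter, Set.compl_subset_compl]
      intro q hq
      refine Set.mem_iInter₂.2 fun δ hδ => ?_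
      obtain ⟨k, hk⟩ := exists_nat_one_div_lt (Set.mem_Ioi.1 hδ)
      exact closure_mono (hmono _ _ hk.le) (Set.mem_iInter.1 hq k)
    refine measure_mono_null hsub (measure_iUnion_null fun k => ?_)
    rw [prob_compl_eq_zero_iff isClosed_closure.measurableSet]
    exact hcl _ (by positivity)
  have hSm : MeasurableSet Sstar := by
    rw [hSstar]
    exact hSclosed.measurableSet.inter (measurableSet_eq_fun hfmeas measurable_const)
  rw [← prob_compl_eq_zero_iff hSm]
  refine measure_mono_null (t := (⋂ δ ∈ Set.Ioi (0 : ℝ), closure (Sdelta δ))ᶜ ∪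
    ((⋂ δ ∈ Set.Ioi (0 : ℝ), closure (Sdelta δ)) \ Sstar)) ?_ (measure_union_null hInter hμ)
  intro q hq
  by_cases h : q ∈ ⋂ δ ∈ Set.Ioi (0 : ℝ), closure (Sdelta δ)
  · exact Or.inr ⟨h, hq⟩
  · exact Or.inl h
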